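/- Let n ≥ 2, r ∈ (0, π/4), and let a, z, p ∈ Sⁿ with z·a < 0. Suppose the closure of B_{p,r} is contained in {v ∈ Sⁿ : v·a ≠ 0} (equivalently, entirely in the open half-sphere {v·a < 0} or entirely in {v·a > 0}), and that ∫_{B_{p,r}} g(z·F_a(v)) π_z(F_a(v)) dv = 0. Then p = z or p = R_a(z). -/

import Mathlib

open MeasureTheory Real
open scoped RealInnerProductSpace

noncomputable section

/-- The unit sphere `Sⁿ ⊆ ℝ^{n+1}`. -/
def sph (n : ℕ) : Set (EuclideanSpace ℝ (Fin (n + 1))) := Metric.sphere 0 1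

/-- Reflection `R_a(z) = z - 2(z·a)a` across the hyperplane `a^⊥`. -/
def sphRefl (n : ℕ) (a z : EuclideanSpace ℝ (Fin (n + 1))) : EuclideanSpace ℝ (Fin (n + 1)) :=
  z - (2 * ⟪z, a⟫) • a

/-- The folding map `F_a` : reflect the open half-sphere `{z·a > 0}` onto `{z·a < 0}`. -/
def fold (n : ℕ) (a z : EuclideanSpace ℝ (Fin (n + 1))) : EuclideanSpace ℝ (Fin (n + 1)) :=
  if 0 < ⟪z, a⟫ then sphRefl n a z else z

/-- Projection `π_z(w) = w - (w·z)z` onto the tangent space `z^⊥`. -/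
def proj (n : ℕ) (z w : EuclideanSpace ℝ (Fin (n + 1))) : EuclideanSpace ℝ (Fin (n + 1)) :=
  w - ⟪w, z⟫ • z

/-- The open geodesic ball `B_{p,r}` on the unit sphere: points of the sphere at geodesic
(angular) distance `arccos (p·v) < r` from `p`. -/
def gball (n : ℕ) (p : EuclideanSpace ℝ (Fin (n + 1))) (r : ℝ) :
    Set (EuclideanSpace ℝ (Fin (n + 1))) :=
  {v | v ∈ sph n ∧ Real.arccos ⟪p, v⟫ < r}

/-- `G(t) = ∫₀ᵗ g(s) ds`. -/
def Gfun (g : ℝ → ℝ) (t : ℝ) : ℝ := ∫ s in (0:ℝ)..t, g s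

section helpers

variable {n : ℕ}

lemma aux_finrank (v : EuclideanSpace ℝ (Fin (n + 1))) (hv : ‖v‖ = 1) :
    Module.finrank ℝ (ℝ ∙ v)ᗮ = n := by
  have : Fact (Module.finrank ℝ (EuclideanSpace ℝ (Fin (n + 1))) = n + 1) := ⟨by simp⟩
  apply Submodule.finrank_orthogonal_span_singleton
  intro h; simp [h] at hv

lemma aux_haar (v : EuclideanSpace ℝ (Fin (n + 1))) (hv : ‖v‖ = 1) :
    Measure.IsAddHaarMeasure (μH[(n:ℝ)] : Measure (ℝ ∙ v)ᗮ) := by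
  have := MeasureTheory.isAddHaarMeasure_hausdorffMeasure (E := (ℝ ∙ v)ᗮ)
  rwa [aux_finrank v hv] at this

lemma aux_orth (v : EuclideanSpace ℝ (Fin (n + 1))) (w : (ℝ ∙ v)ᗮ) :
    ⟪v, (w : EuclideanSpace ℝ (Fin (n + 1)))⟫ = 0 :=
  Submodule.mem_orthogonal_singleton_iff_inner_right.1 w.2

lemma aux_pos (U : Set (EuclideanSpace ℝ (Fin (n + 1)))) (hU : IsOpen U)
    (v : EuclideanSpace ℝ (Fin (n + 1))) (hvU : v ∈ U) (hv : ‖v‖ = 1) :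
    0 < μH[(n:ℝ)] (U ∩ sph n) := by
  have := aux_haar v hv
  let φ : (ℝ ∙ v)ᗮ → EuclideanSpace ℝ (Fin (n + 1)) := fun w => √(1 - ‖w‖ ^ 2) • v + w
  have hφ : Continuous φ := by fun_prop
  have hopen : IsOpen (φ ⁻¹' U ∩ Metric.ball 0 1) := (hU.preimage hφ).inter Metric.isOpen_ball
  have hne : (φ ⁻¹' U ∩ Metric.ball 0 1).Nonempty := ⟨0, by simp [φ, hvU], by simp⟩
  have h1 := hopen.measure_pos (μH[(n:ℝ)]) hne
  have hL : LipschitzWith 1 ((ℝ ∙ v)ᗮ.orthogonalProjectionOnto) :=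
    Submodule.lipschitzWith_orthogonalProjectionOnto _
  have h2 := hL.hausdorffMeasure_image_le (d := n) (by positivity) (U ∩ sph n)
  simp only [ENNReal.coe_one, ENNReal.one_rpow, one_mul] at h2
  refine lt_of_lt_of_le h1 (le_trans (measure_mono ?_) h2)
  rintro w ⟨hwU, hw⟩
  refine ⟨φ w, ⟨hwU, ?_⟩, ?_⟩
  · have hw1 : ‖w‖ < 1 := by simpa using hw
    have : ‖φ w‖ ^ 2 = 1 := by
      simp only [φ]
      rw [norm_add_sq_real, norm_smul, inner_smul_left, aux_orth, hv]
      have : 0 ≤ 1 - ‖w‖ ^ 2 := by nlinarith [norm_nonneg w]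
      simp only [mul_one, mul_zero, add_zero, norm_eq_abs, sq_abs, sq_sqrt this]
      simp
    have : ‖φ w‖ = 1 := by
      rwa [pow_eq_one_iff_of_nonneg (norm_nonneg (φ w)) two_ne_zero] at this
    simpa [sph] using this
  · simp only [φ, map_add, map_smul]
    have : (ℝ ∙ v)ᗮ.orthogonalProjectionOnto v = 0 := by
      apply Submodule.orthogonalProjectionOnto_orthogonal_apply_eq_zero
      exact Submodule.mem_span_singleton_self v
    simp [this]

lemma aux_fin (p : EuclideanSpace ℝ (Fin (n + 1))) (hp : ‖p‖ = 1) (c : ℝ) (hc : 0 < c) :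
    μH[(n:ℝ)] {v | v ∈ sph n ∧ c < ⟪p, v⟫} < ⊤ := by
  have := aux_haar p hp
  let φ : (ℝ ∙ p)ᗮ → EuclideanSpace ℝ (Fin (n + 1)) :=
    fun w => (√(1 + ‖w‖ ^ 2))⁻¹ • (p + w)
  have hφ : ContDiff ℝ 1 φ := by
    have h0 : ContDiff ℝ 1 (fun w : (ℝ ∙ p)ᗮ => 1 + ‖w‖ ^ 2) :=
      contDiff_const.add (contDiff_norm_sq ℝ)
    refine ContDiff.smul (ContDiff.inv (h0.sqrt ?_) ?_)
      (contDiff_const.add ((ℝ ∙ p)ᗮ.subtypeL.contDiff))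
    · intro x; positivity
    · intro x; positivity
  obtain ⟨K, hK⟩ := (hφ.locallyLipschitz.locallyLipschitzOn
    (s := Metric.closedBall 0 (c⁻¹ + 1))).exists_lipschitzOnWith_of_compact
      (isCompact_closedBall _ _)
  have h2 := hK.hausdorffMeasure_image_le (d := n) (by positivity)
  refine lt_of_le_of_lt (measure_mono ?_) (lt_of_le_of_lt h2 ?_)
  · rintro v ⟨hv, hcv⟩
    have hv : ‖v‖ = 1 := by simpa [sph] using hv
    set t := ⟪p, v⟫ with ht
    have ht0 : 0 < t := hc.trans hcv
    have hpp : ⟪p, p⟫ = 1 := by simp [hp]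
    refine ⟨⟨t⁻¹ • v - p, ?_⟩, ?_, ?_⟩
    · rw [Submodule.mem_orthogonal_singleton_iff_inner_right, inner_sub_right, inner_smul_right,
        hpp, ← ht, inv_mul_cancel₀ ht0.ne', sub_self]
    · simp only [Metric.mem_closedBall, dist_zero_right, Submodule.coe_norm]
      refine (norm_sub_le _ _).trans ?_
      rw [norm_smul, hv, hp, norm_inv, mul_one, Real.norm_of_nonneg ht0.le]
      gcongr
    · have : ‖t⁻¹ • v - p‖ ^ 2 = (t⁻¹) ^ 2 - 1 := by
        rw [norm_sub_sq_real, norm_smul, inner_smul_left, real_inner_comm, ← ht, hv, hp]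
        simp [ht0.ne']; ring
      simp only [φ, Submodule.coe_norm, this]
      rw [add_sub_cancel, Real.sqrt_sq (by positivity)]
      simp [smul_smul, ht0.ne']
  · exact ENNReal.mul_lt_top (by simp) (isCompact_closedBall _ _).measure_lt_top

lemma aux_refl (a z : EuclideanSpace ℝ (Fin (n + 1))) (ha : ‖a‖ = 1) :
    (ℝ ∙ a)ᗮ.reflection z = sphRefl n a z := by
  rw [Submodule.reflection_orthogonal_apply, Submodule.reflection_singleton_apply, sphRefl,
    ha, real_inner_comm]
  simp [two_smul, mul_smul]

lemma aux_gball (p v : EuclideanSpace ℝ (Fin (n + 1))) (hp : ‖p‖ = 1) (r : ℝ)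
    (hr : r ∈ Set.Ioo 0 (π / 4)) : v ∈ gball n p r ↔ ‖v‖ = 1 ∧ cos r < ⟪p, v⟫ := by
  have hs : v ∈ sph n ↔ ‖v‖ = 1 := by simp [sph]
  have hpi := Real.pi_pos
  obtain ⟨h0, h1⟩ := hr
  simp only [gball, Set.mem_ofPred_eq, hs]
  refine and_congr_right fun hv => ?_
  have hb := abs_real_inner_le_norm p v
  rw [hp, hv, mul_one, abs_le] at hb
  rw [← Real.cos_arccos hb.1 hb.2, Real.strictAntiOn_cos.lt_iff_gt,
    Real.cos_arccos hb.1 hb.2]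
  · exact ⟨h0.le, by linarith⟩
  · exact ⟨Real.arccos_nonneg _, Real.arccos_le_pi _⟩

lemma aux_meas (p : EuclideanSpace ℝ (Fin (n + 1))) (hp : ‖p‖ = 1) (r : ℝ)
    (hr : r ∈ Set.Ioo 0 (π / 4)) : MeasurableSet (gball n p r) := by
  have hB : gball n p r = Metric.sphere 0 1 ∩ {v | cos r < ⟪p, v⟫} := by
    ext v; rw [aux_gball p v hp r hr]; simp
  rw [hB]
  have h1 : IsOpen {v : EuclideanSpace ℝ (Fin (n + 1)) | cos r < ⟪p, v⟫} :=
    isOpen_lt continuous_const (by fun_prop)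
  exact Metric.isClosed_sphere.measurableSet.inter h1.measurableSet

lemma aux_R (w : EuclideanSpace ℝ (Fin (n + 1))) (hw : ‖w‖ = 1) :
    ∃ R : EuclideanSpace ℝ (Fin (n + 1)) → EuclideanSpace ℝ (Fin (n + 1)),
      (∀ v, R v = v - (2 * ⟪v, w⟫) • w) ∧ (∀ v, ‖R v‖ = ‖v‖) ∧
      MeasurePreserving R (μH[(n:ℝ)]) (μH[(n:ℝ)]) ∧ MeasurableEmbedding R := by
  refine ⟨(ℝ ∙ w)ᗮ.reflection, fun v => aux_refl w v hw, fun v => LinearIsometryEquiv.norm_map _ v,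
    ?_, ?_⟩
  · exact (ℝ ∙ w)ᗮ.reflection.toIsometryEquiv.measurePreserving_hausdorffMeasure _
  · exact (ℝ ∙ w)ᗮ.reflection.toHomeomorph.measurableEmbedding

set_option maxHeartbeats 1000000 in
lemma aux_core (hn : 2 ≤ n) (g : ℝ → ℝ) (hg_cont : ContinuousOn g (Set.Icc (-1) 1))
    (hg_nonneg : ∀ t ∈ Set.Icc (-1:ℝ) 1, 0 ≤ g t)
    (hg_pos : ∀ t ∈ Set.Ioo (-1:ℝ) 1, 0 < g t)
    (r : ℝ) (hr : r ∈ Set.Ioo 0 (π / 4))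
    (z p : EuclideanSpace ℝ (Fin (n + 1))) (hz : ‖z‖ = 1) (hp : ‖p‖ = 1)
    (hcrit : (∫ v in gball n p r, g ⟪z, v⟫ • proj n z v ∂μH[(n:ℝ)]) = 0) :
    p = z ∨ p = -z := by
  by_contra hcon
  push Not at hcon
  have hpi := Real.pi_pos
  have hcos : 0 < cos r := Real.cos_pos_of_mem_Ioo ⟨by linarith [hr.1], by linarith [hr.2]⟩
  have hzz : ⟪z, z⟫ = 1 := by simp [hz]
  have hpp : ⟪p, p⟫ = 1 := by simp [hp]
  have hB : gball n p r = {v | v ∈ sph n ∧ cos r < ⟪p, v⟫} := by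
    ext v; rw [aux_gball p v hp r hr]; simp [sph]
  have hBmeas := aux_meas p hp r hr
  have hBfin : μH[(n:ℝ)] (gball n p r) < ⊤ := by rw [hB]; exact aux_fin p hp _ hcos
  -- continuous extension of g
  let g' : ℝ → ℝ := Set.IccExtend (by norm_num : (-1:ℝ) ≤ 1) (Set.domRestrict (Set.Icc (-1:ℝ) 1) g)
  have hg'c : Continuous g' := (continuousOn_iff_continuous_domRestrict.1 hg_cont).Icc_extend'
  have hg'e : ∀ t ∈ Set.Icc (-1:ℝ) 1, g' t = g t := fun t ht => by
    simp only [g']; rw [Set.IccExtend_of_mem _ _ ht]; rfl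
  have hin : ∀ v : EuclideanSpace ℝ (Fin (n + 1)), ‖v‖ = 1 → ⟪z, v⟫ ∈ Set.Icc (-1:ℝ) 1 := by
    intro v hv
    have hb := abs_real_inner_le_norm z v
    rw [hz, hv, mul_one, abs_le] at hb
    exact hb
  obtain ⟨C, hC⟩ := (isCompact_Icc (a := (-1:ℝ)) (b := 1)).exists_bound_of_continuousOn hg_cont
  have hBn : ∀ v ∈ gball n p r, ‖v‖ = 1 := fun v hv => ((aux_gball p v hp r hr).1 hv).1
  set q := p - ⟪p, z⟫ • z with hq
  have hqz : ⟪z, q⟫ = 0 := by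
    rw [hq, inner_sub_right, inner_smul_right, hzz, real_inner_comm]; ring
  have hq0 : q ≠ 0 := by
    intro h0
    have h1 : p = ⟪p, z⟫ • z := sub_eq_zero.1 h0
    have h2 : |⟪p, z⟫| = 1 := by
      have := congrArg norm h1
      rw [norm_smul, hz, hp] at this
      simpa using this.symm
    rcases (abs_eq zero_le_one).1 h2 with h | h
    · exact hcon.1 (by rw [h] at h1; simpa using h1)
    · exact hcon.2 (by rw [h] at h1; simpa using h1)
  have hqn : 0 < ‖q‖ := norm_pos_iff.2 hq0
  set w := (‖q‖)⁻¹ • q with hw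
  have hwn : ‖w‖ = 1 := by rw [hw, norm_smul]; simp [hqn.ne']
  have hzw : ⟪z, w⟫ = 0 := by rw [hw, inner_smul_right, hqz, mul_zero]
  have hpw : 0 < ⟪p, w⟫ := by
    have : ⟪p, q⟫ = ‖q‖ ^ 2 := by
      have : p = q + ⟪p, z⟫ • z := by rw [hq]; abel
      conv_lhs => rw [this]
      rw [inner_add_left, inner_smul_left, hqz]; simp
    rw [hw, inner_smul_right, this]; positivity
  clear_value w
  clear_value q
  have hint : IntegrableOn (fun v => g ⟪z, v⟫ • proj n z v) (gball n p r) μH[(n:ℝ)] := by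
    have hc' : Continuous (fun v => g' ⟪z, v⟫ • proj n z v) := by
      unfold proj
      fun_prop
    refine IntegrableOn.of_bound (C := C * 2) hBfin ?_ ?_
    · refine (hc'.aestronglyMeasurable).congr ?_
      filter_upwards [ae_restrict_mem hBmeas] with v hv
      rw [hg'e _ (hin v (hBn v hv))]
    · filter_upwards [ae_restrict_mem hBmeas] with v hv
      have hv1 := hBn v hv
      rw [norm_smul]
      refine mul_le_mul (hC _ (hin v hv1)) ?_ (norm_nonneg _)
        ((norm_nonneg _).trans (hC _ (hin v hv1)))
      refine (norm_sub_le _ _).trans ?_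
      have := hin v hv1
      rw [norm_smul, hv1, hz, mul_one, real_inner_comm, Real.norm_eq_abs]
      have := abs_le.2 this
      linarith
  let f : EuclideanSpace ℝ (Fin (n + 1)) → ℝ := fun v => g ⟪z, v⟫ * ⟪v, w⟫
  have hfeq : ∀ v, f v = ⟪w, g ⟪z, v⟫ • proj n z v⟫ := by
    intro v
    simp only [f, proj]
    rw [inner_smul_right, inner_sub_right, inner_smul_right, real_inner_comm z w, hzw,
      real_inner_comm w v]
    ring
  have hfint : IntegrableOn f (gball n p r) μH[(n:ℝ)] := by
    have := hint.const_inner (𝕜 := ℝ) w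
    exact this.congr (Filter.Eventually.of_forall fun v => (hfeq v).symm)
  have hf0 : ∫ v in gball n p r, f v ∂μH[(n:ℝ)] = 0 := by
    simp_rw [hfeq]
    rw [integral_inner hint, hcrit, inner_zero_right]
  obtain ⟨R, hR, hRn, hRmp, hRe⟩ := aux_R w hwn
  have hRw : ∀ v, ⟪R v, w⟫ = -⟪v, w⟫ := by
    intro v
    rw [hR, inner_sub_left, inner_smul_left]; simp [hwn]; ring
  have hRz : ∀ v, ⟪z, R v⟫ = ⟪z, v⟫ := by
    intro v
    rw [hR, inner_sub_right, inner_smul_right, hzw]; simp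
  have hRp : ∀ v, ⟪p, R v⟫ = ⟪p, v⟫ - 2 * ⟪v, w⟫ * ⟪p, w⟫ := by
    intro v
    rw [hR, inner_sub_right, inner_smul_right]
  have hfR : ∀ v, f (R v) = - f v := by
    intro v; simp only [f]; rw [hRw, hRz]; ring
  let h := (gball n p r).indicator f
  have hhint : Integrable h μH[(n:ℝ)] := (integrable_indicator_iff hBmeas).2 hfint
  have hhRint : Integrable (fun v => h (R v)) μH[(n:ℝ)] :=
    (hRmp.integrable_comp_emb hRe).2 hhint
  have hh0 : ∫ v, h v ∂μH[(n:ℝ)] = 0 := by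
    simp only [h]; rw [integral_indicator hBmeas, hf0]
  have hhR0 : ∫ v, h (R v) ∂μH[(n:ℝ)] = 0 := by
    rw [hRmp.integral_comp hRe, hh0]
  have hfnn : ∀ v, ‖v‖ = 1 → 0 ≤ ⟪v, w⟫ → 0 ≤ f v := fun v hv h1 =>
    mul_nonneg (hg_nonneg _ (hin v hv)) h1
  have hnn : ∀ v, 0 ≤ h v + h (R v) := by
    intro v
    by_cases h1 : v ∈ gball n p r <;> by_cases h2 : R v ∈ gball n p r
    · simp [h, h1, h2, hfR]
    · simp only [h, Set.indicator_of_mem h1, Set.indicator_of_notMem h2, add_zero]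
      rw [aux_gball _ _ hp r hr] at h1 h2
      refine hfnn v h1.1 ?_
      by_contra hneg
      push Not at hneg
      refine h2 ⟨by rw [hRn, h1.1], ?_⟩
      rw [hRp]; nlinarith
    · simp only [h, Set.indicator_of_mem h2, Set.indicator_of_notMem h1, zero_add]
      rw [aux_gball _ _ hp r hr] at h1 h2
      refine hfnn _ h2.1 ?_
      by_contra hneg
      push Not at hneg
      rw [hRw] at hneg
      refine h1 ⟨by rw [← hRn, h2.1], ?_⟩
      have := h2.2
      rw [hRp] at this; nlinarith
    · simp [h, h1, h2]
  have hsum : ∫ v, (h v + h (R v)) ∂μH[(n:ℝ)] = 0 := by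
    rw [integral_add hhint hhRint, hh0, hhR0, add_zero]
  have hae := (integral_eq_zero_iff_of_nonneg (fun v => hnn v) (hhint.add hhRint)).1 hsum
  let U : Set (EuclideanSpace ℝ (Fin (n + 1))) :=
    {v | cos r < ⟪p, v⟫} ∩ {v | ⟪p, v⟫ - 2 * ⟪v, w⟫ * ⟪p, w⟫ < cos r} ∩ {v | 0 < ⟪v, w⟫}
  have hU : IsOpen U :=
    ((isOpen_lt continuous_const (by fun_prop)).inter
      (isOpen_lt (by fun_prop) continuous_const)).inter
      (isOpen_lt continuous_const (by fun_prop))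
  have hUpos : ∀ v ∈ U ∩ sph n, h v + h (R v) ≠ 0 := by
    rintro v ⟨⟨⟨h1, h2⟩, h3⟩, hv⟩
    simp only [Set.mem_ofPred_eq] at h1 h2 h3
    have hv : ‖v‖ = 1 := by simpa [sph] using hv
    have m1 : v ∈ gball n p r := (aux_gball _ _ hp r hr).2 ⟨hv, h1⟩
    have m2 : R v ∉ gball n p r := fun hm => by
      have := ((aux_gball _ _ hp r hr).1 hm).2
      rw [hRp] at this; linarith
    simp only [h, Set.indicator_of_mem m1, Set.indicator_of_notMem m2, add_zero]
    refine (mul_pos (hg_pos _ ?_) h3).ne'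
    have hb := hin v hv
    refine ⟨lt_of_le_of_ne hb.1 ?_, lt_of_le_of_ne hb.2 ?_⟩
    · intro he
      have : ⟪z, -v⟫ = 1 := by rw [inner_neg_right, ← he]; ring
      have := (inner_eq_one_iff_of_norm_eq_one hz (by simpa using hv)).1 this
      have h4 : v = -z := by rw [this]; simp
      rw [h4, inner_neg_left, hzw] at h3
      simp at h3
    · intro he
      have := (inner_eq_one_iff_of_norm_eq_one hz hv).1 he
      rw [← this, hzw] at h3
      simp at h3
  -- nonempty
  have hUne : ∃ v ∈ U, ‖v‖ = 1 := by
    have hu : ∃ u : EuclideanSpace ℝ (Fin (n + 1)), ‖u‖ = 1 ∧ ⟪p, u⟫ = 0 ∧ 0 ≤ ⟪u, w⟫ := by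
      have : Nontrivial (ℝ ∙ p)ᗮ := by
        apply Module.nontrivial_of_finrank_pos (R := ℝ)
        rw [aux_finrank p hp]; omega
      obtain ⟨u, hu⟩ := exists_norm_eq (ℝ ∙ p)ᗮ (c := 1) zero_le_one
      rcases le_total 0 ⟪(u : EuclideanSpace ℝ (Fin (n + 1))), w⟫ with h | h
      · exact ⟨u, hu, aux_orth p u, h⟩
      · refine ⟨-u, by rw [norm_neg]; exact hu, by rw [inner_neg_right, aux_orth]; simp, ?_⟩
        rw [inner_neg_left]; linarith
    obtain ⟨u, hu1, hu2, hu3⟩ := hu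
    let γ : ℝ → EuclideanSpace ℝ (Fin (n + 1)) := fun t => cos t • p + sin t • u
    have hγc : Continuous γ := by fun_prop
    have hγn : ∀ t, ‖γ t‖ = 1 := by
      intro t
      have : ‖γ t‖ ^ 2 = 1 := by
        simp only [γ]
        rw [norm_add_sq_real, norm_smul, norm_smul, inner_smul_left, inner_smul_right, hu2, hp, hu1]
        simp
      rwa [pow_eq_one_iff_of_nonneg (norm_nonneg (γ t)) two_ne_zero] at this
    have hγp : ∀ t, ⟪p, γ t⟫ = cos t := by
      intro t
      simp only [γ]
      rw [inner_add_right, inner_smul_right, inner_smul_right, hu2, hpp]; ring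
    have hrw : 0 < ⟪γ r, w⟫ := by
      simp only [γ]
      rw [inner_add_left, inner_smul_left, inner_smul_left]
      have : 0 ≤ sin r := Real.sin_nonneg_of_nonneg_of_le_pi hr.1.le (by linarith [hr.2])
      have := mul_nonneg this hu3
      have := mul_pos hcos hpw
      simp only [conj_trivial]
      linarith
    have c1 : Continuous fun t => cos t - 2 * ⟪γ t, w⟫ * ⟪p, w⟫ := by fun_prop
    have c2 : Continuous fun t => ⟪γ t, w⟫ := by fun_prop
    have e1 : ∀ᶠ t in nhds r, cos t - 2 * ⟪γ t, w⟫ * ⟪p, w⟫ < cos r :=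
      c1.continuousAt.eventually_lt_const (by have := mul_pos hrw hpw; linarith)
    have e2 : ∀ᶠ t in nhds r, 0 < ⟪γ t, w⟫ := c2.continuousAt.eventually_const_lt hrw
    have e3 : ∀ᶠ t in nhds r, 0 < t := eventually_gt_nhds hr.1
    have e4 : ∀ᶠ t in nhdsWithin r (Set.Iio r), t < r := self_mem_nhdsWithin
    obtain ⟨t, htr, ht⟩ :=
      (((e1.and (e2.and e3)).filter_mono nhdsWithin_le_nhds).and e4).exists
    refine ⟨γ t, ⟨⟨?_, ?_⟩, htr.2.1⟩, hγn t⟩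
    · simp only [Set.mem_ofPred_eq, hγp]
      exact Real.cos_lt_cos_of_nonneg_of_le_pi htr.2.2.le (by linarith [hr.2]) ht
    · simp only [Set.mem_ofPred_eq, hγp]; exact htr.1
  obtain ⟨v, hvU, hv⟩ := hUne
  have hpos := aux_pos U hU v hvU hv
  have hz0 : μH[(n:ℝ)] (U ∩ sph n) = 0 :=
    measure_mono_null (fun v hv => hUpos v hv) (ae_iff.1 hae)
  exact hpos.ne' hz0

lemma aux_sign (r : ℝ) (hr : r ∈ Set.Ioo 0 (π / 4))
    (a p : EuclideanSpace ℝ (Fin (n + 1))) (hp : ‖p‖ = 1)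
    (hB : ∀ v ∈ gball n p r, ⟪v, a⟫ ≠ 0) (v : EuclideanSpace ℝ (Fin (n + 1)))
    (hv : v ∈ gball n p r) : 0 < ⟪p, a⟫ * ⟪v, a⟫ := by
  have hpi := Real.pi_pos
  have hcos : 0 < cos r := Real.cos_pos_of_mem_Ioo ⟨by linarith [hr.1], by linarith [hr.2]⟩
  have hpp : ⟪p, p⟫ = 1 := by simp [hp]
  have hpB : p ∈ gball n p r := by
    rw [aux_gball _ _ hp r hr, hpp]
    refine ⟨hp, ?_⟩
    have := Real.cos_lt_cos_of_nonneg_of_le_pi le_rfl (by linarith [hr.2]) hr.1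
    simpa using this
  by_contra hneg
  have hva := hB v hv
  have hpa := hB p hpB
  have hlt : ⟪p, a⟫ * ⟪v, a⟫ < 0 := lt_of_le_of_ne (not_lt.1 hneg) (mul_ne_zero hpa hva)
  obtain ⟨hvn, hvc⟩ := (aux_gball _ _ hp r hr).1 hv
  have key : ∃ s t : ℝ, 0 ≤ s ∧ 0 ≤ t ∧ s + t = 1 ∧ s * ⟪p, a⟫ + t * ⟪v, a⟫ = 0 := by
    have hd : 0 < |⟪v, a⟫| + |⟪p, a⟫| := by positivity
    refine ⟨|⟪v, a⟫| / (|⟪v, a⟫| + |⟪p, a⟫|), |⟪p, a⟫| / (|⟪v, a⟫| + |⟪p, a⟫|),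
      by positivity, by positivity, by field_simp, ?_⟩
    rw [div_mul_eq_mul_div, div_mul_eq_mul_div, ← add_div, div_eq_zero_iff]
    left
    rcases mul_neg_iff.1 hlt with ⟨h1, h2⟩ | ⟨h1, h2⟩
    · rw [abs_of_pos h1, abs_of_neg h2]; ring
    · rw [abs_of_neg h1, abs_of_pos h2]; ring
  obtain ⟨s, t, hs, ht, hst, h0⟩ := key
  set x := s • p + t • v with hx
  have hxn : ‖x‖ ≤ 1 := by
    refine (norm_add_le _ _).trans ?_
    rw [norm_smul, norm_smul, hp, hvn, Real.norm_of_nonneg hs, Real.norm_of_nonneg ht]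
    linarith
  have hpv1 : ⟪p, v⟫ ≤ 1 := by
    have := real_inner_le_norm p v
    rwa [hp, hvn, mul_one] at this
  have hpx : cos r < ⟪p, x⟫ := by
    rw [hx, inner_add_right, inner_smul_right, inner_smul_right, hpp]
    nlinarith
  have hx0 : 0 < ‖x‖ := by
    rw [norm_pos_iff]
    intro h
    rw [h, inner_zero_right] at hpx
    linarith
  refine hB (‖x‖⁻¹ • x) ((aux_gball _ _ hp r hr).2 ⟨?_, ?_⟩) ?_
  · rw [norm_smul]; simp [hx0.ne']
  · rw [inner_smul_right]
    have : 1 ≤ ‖x‖⁻¹ := (one_le_inv₀ hx0).2 hxn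
    nlinarith
  · rw [inner_smul_left, hx, inner_add_left, inner_smul_left, inner_smul_left]
    simp only [conj_trivial]
    rw [h0, mul_zero]

end helpers

/-- For `r ∈ (0, π/4)` and `a, z, p ∈ Sⁿ` with `z·a < 0`, if the closure of
`B_{p,r}` does not meet the equator `a^⊥` (i.e. `v·a ≠ 0` on the closure) and
`∫_{B_{p,r}} g(z·F_a v) π_z(F_a v) dv = 0`, then `p = z` or `p = R_a(z)`. -/
theorem statement8 (n : ℕ) (hn : 2 ≤ n)
    (g : ℝ → ℝ) (hg_cont : ContinuousOn g (Set.Icc (-1) 1))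
    (hg_even : ∀ t, g (-t) = g t)
    (hg_nonneg : ∀ t ∈ Set.Icc (-1:ℝ) 1, 0 ≤ g t)
    (hg_pos : ∀ t ∈ Set.Ioo (-1:ℝ) 1, 0 < g t)
    (r : ℝ) (hr : r ∈ Set.Ioo 0 (π / 4))
    (a z p : EuclideanSpace ℝ (Fin (n + 1)))
    (ha : a ∈ sph n) (hz : z ∈ sph n) (hp : p ∈ sph n)
    (hza : ⟪z, a⟫ < 0)
    (hclos : ∀ v ∈ closure (gball n p r), ⟪v, a⟫ ≠ 0)
    (hcrit : (∫ v in gball n p r, g ⟪z, fold n a v⟫ • proj n z (fold n a v) ∂μH[(n:ℝ)]) = 0) :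
    p = z ∨ p = sphRefl n a z := by
  have ha' : ‖a‖ = 1 := by simpa [sph] using ha
  have hz' : ‖z‖ = 1 := by simpa [sph] using hz
  have hp' : ‖p‖ = 1 := by simpa [sph] using hp
  have hsgn := aux_sign r hr a p hp' (fun v hv => hclos v (subset_closure hv))
  have hBmeas := aux_meas p hp' r hr
  have hpp : ⟪p, p⟫ = 1 := by simp [hp']
  have hpB : p ∈ gball n p r := by
    rw [aux_gball _ _ hp' r hr, hpp]
    refine ⟨hp', ?_⟩
    have := Real.cos_lt_cos_of_nonneg_of_le_pi le_rfl (by linarith [hr.2, Real.pi_pos]) hr.1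
    simpa using this
  have hpa := hclos p (subset_closure hpB)
  rcases lt_or_gt_of_ne hpa with hpa | hpa
  · left
    have : (∫ v in gball n p r, g ⟪z, v⟫ • proj n z v ∂μH[(n:ℝ)]) = 0 := by
      rw [← hcrit]
      refine setIntegral_congr_fun hBmeas fun v hv => ?_
      have h1 : ¬ 0 < ⟪v, a⟫ := by have := hsgn v hv; nlinarith
      simp only [fold, if_neg h1]
    rcases aux_core hn g hg_cont hg_nonneg hg_pos r hr z p hz' hp' this with h | h
    · exact h
    · rw [h, inner_neg_left] at hpa; linarith
  · right
    let R := (ℝ ∙ a)ᗮ.reflection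
    have hR : ∀ v, R v = sphRefl n a v := fun v => aux_refl a v ha'
    have hRmp : MeasurePreserving R (μH[(n:ℝ)]) (μH[(n:ℝ)]) :=
      R.toIsometryEquiv.measurePreserving_hausdorffMeasure _
    have hRe : MeasurableEmbedding R := R.toHomeomorph.measurableEmbedding
    have hRR : ∀ v, R (R v) = v := fun v => Submodule.reflection_reflection _ v
    have hRp : ‖R p‖ = 1 := by rw [R.norm_map, hp']
    have hpre : R ⁻¹' (gball n (R p) r) = gball n p r := by
      ext v
      rw [Set.mem_preimage, aux_gball _ _ hRp r hr, aux_gball _ _ hp' r hr, R.norm_map,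
        R.inner_map_map]
    have hRa : ⟪R p, a⟫ = -⟪p, a⟫ := by
      rw [hR, sphRefl, inner_sub_left, inner_smul_left]; simp [ha']; ring
    have : (∫ v in gball n (R p) r, g ⟪z, v⟫ • proj n z v ∂μH[(n:ℝ)]) = 0 := by
      rw [← hRmp.setIntegral_preimage_emb hRe, hpre, ← hcrit]
      refine setIntegral_congr_fun hBmeas fun v hv => ?_
      have h1 : 0 < ⟪v, a⟫ := by have := hsgn v hv; exact pos_of_mul_pos_right this hpa.le
      simp only [fold, if_pos h1, hR]
    rcases aux_core hn g hg_cont hg_nonneg hg_pos r hr z (R p) hz' hRp this with h | h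
    · rw [← hR, ← h, hRR]
    · rw [h, inner_neg_left] at hRa; linarith
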